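/- Let G be a connected simple graph with maximum degree at most 4 and suppose there is a list assignment L with |L(e)| ≥ 22 for every edge e such that G is not strongly L-edge-colorable but every proper subgraph of G is strongly L-edge-colorable (restricting L to its edges). Then G contains no cycle of length 4. -/

import Mathlib

/-- Two edges are "close" (distance at most 1): some endpoint of one equals,
or is adjacent to, some endpoint of the other. In a strong edge-coloring,
distinct close edges must get distinct colors. -/
def EdgeClose {V : Type*} (G : SimpleGraph V) (e₁ e₂ : Sym2 V) : Prop :=
  ∃ u w, u ∈ e₁ ∧ w ∈ e₂ ∧ (u = w ∨ G.Adj u w)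

/-- `c` is a strong edge-coloring of `G` (viewed as a function on all of `Sym2 V`,
only its values on edges of `G` matter). -/
def IsStrongEdgeColoringOn {V : Type*} (G : SimpleGraph V) (c : Sym2 V → ℕ) : Prop :=
  ∀ e₁ ∈ G.edgeSet, ∀ e₂ ∈ G.edgeSet, e₁ ≠ e₂ → EdgeClose G e₁ e₂ → c e₁ ≠ c e₂

/-- `G` is strongly `L`-edge-colorable. -/
def StronglyLColorable {V : Type*} (G : SimpleGraph V) (L : Sym2 V → Finset ℕ) : Prop :=
  ∃ c : Sym2 V → ℕ, IsStrongEdgeColoringOn G c ∧ ∀ e ∈ G.edgeSet, c e ∈ L e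

/-- `G` is strongly `k`-edge-choosable. -/
def StronglyEdgeChoosable {V : Type*} (G : SimpleGraph V) (k : ℕ) : Prop :=
  ∀ L : Sym2 V → Finset ℕ, (∀ e ∈ G.edgeSet, k ≤ (L e).card) → StronglyLColorable G L


section Helpers

theorem hall_aux {α : Type*} [DecidableEq α] (U : Finset α) (A : α → Finset ℕ)
    (h : ∀ T ⊆ U, T.Nonempty → (∃ e ∈ T, T.card ≤ (A e).card) ∨
      (∃ e ∈ T, ∃ f ∈ T, Disjoint (A e) (A f) ∧ T.card ≤ (A e).card + (A f).card)) :
    ∃ g : α → ℕ, (∀ e ∈ U, g e ∈ A e) ∧ ∀ e ∈ U, ∀ f ∈ U, g e = g f → e = f := by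
  have key : ∀ s : Finset {x // x ∈ U}, s.card ≤ (s.biUnion (fun x => A x.1)).card := by
    intro s
    rcases s.eq_empty_or_nonempty with rfl | hs
    · simp
    have h1 := h (s.map (Function.Embedding.subtype _)) (by
      intro x hx
      simp at hx
      exact hx.1) (by simpa using hs)
    rw [Finset.card_map] at h1
    rcases h1 with ⟨e, he, hc⟩ | ⟨e, he, f, hf, hd, hc⟩
    · simp at he
      obtain ⟨heU, hes⟩ := he
      exact hc.trans (Finset.card_le_card (Finset.subset_biUnion_of_mem (fun x : {x // x ∈ U} => A x.1) hes))
    · simp at he hf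
      obtain ⟨heU, hes⟩ := he
      obtain ⟨hfU, hfs⟩ := hf
      rw [← Finset.card_union_of_disjoint hd] at hc
      exact hc.trans (Finset.card_le_card (Finset.union_subset
        (Finset.subset_biUnion_of_mem (fun x : {x // x ∈ U} => A x.1) hes)
        (Finset.subset_biUnion_of_mem (fun x : {x // x ∈ U} => A x.1) hfs)))
  obtain ⟨g, hg, hg'⟩ := (Finset.all_card_le_biUnion_card_iff_exists_injective _).1 key
  refine ⟨fun x => if hx : x ∈ U then g ⟨x, hx⟩ else 0, ?_, ?_⟩
  · intro e he
    simpa [he] using hg' ⟨e, he⟩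
  · intro e he f hf hef
    simp only [he, hf, dif_pos] at hef
    simpa using hg hef

theorem card_le_of_not_mem {α : Type*} [DecidableEq α] {T U : Finset α} (h : T ⊆ U) {e : α}
    (he : e ∈ U) (he' : e ∉ T) : T.card + 1 ≤ U.card :=
  Finset.card_lt_card ⟨h, fun h' => he' (h' he)⟩

theorem one_pair {α : Type*} [DecidableEq α] (U C : Finset α) (A : α → Finset ℕ) (n m : ℕ)
    (hU : U.card ≤ n + 1) (hP : (U \ C).card ≤ m + 1) (hnm : n + 1 ≤ 2 * m)
    (hC : ∀ e ∈ U, e ∈ C → n ≤ (A e).card) (hA : ∀ e ∈ U, e ∉ C → m ≤ (A e).card)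
    (e1 e3 : α) (h13 : e1 ≠ e3) (h1 : e1 ∈ U \ C) (h3 : e3 ∈ U \ C) :
    ∃ g : α → ℕ, (∀ e ∈ U, g e ∈ A e) ∧ ∀ e ∈ U, ∀ f ∈ U, g e = g f →
      e = f ∨ (e = e1 ∧ f = e3) ∨ (e = e3 ∧ f = e1) := by
  have h1' := Finset.mem_sdiff.1 h1
  have h3' := Finset.mem_sdiff.1 h3
  by_cases hd : Disjoint (A e1) (A e3)
  · obtain ⟨g, hg, hg'⟩ := hall_aux U A (by
      intro T hT hne
      by_cases hb : e1 ∈ T ∧ e3 ∈ T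
      · right
        refine ⟨e1, hb.1, e3, hb.2, hd, ?_⟩
        have a1 := hA e1 h1'.1 h1'.2
        have a3 := hA e3 h3'.1 h3'.2
        have := Finset.card_le_card hT
        omega
      · left
        by_cases hc : ∃ e ∈ T, e ∈ C
        · obtain ⟨e, he, heC⟩ := hc
          refine ⟨e, he, le_trans ?_ (hC e (hT he) heC)⟩
          have : T.card + 1 ≤ U.card := by
            by_cases h : e1 ∈ T
            · exact card_le_of_not_mem hT h3'.1 (fun h' => hb ⟨h, h'⟩)
            · exact card_le_of_not_mem hT h1'.1 h
          omega
        · push Not at hc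
          have hT' : T ⊆ U \ C := fun x hx => Finset.mem_sdiff.2 ⟨hT hx, hc x hx⟩
          obtain ⟨e, he⟩ := hne
          refine ⟨e, he, le_trans ?_ (hA e (hT he) (hc e he))⟩
          have : T.card + 1 ≤ (U \ C).card := by
            by_cases h : e1 ∈ T
            · exact card_le_of_not_mem hT' h3 (fun h' => hb ⟨h, h'⟩)
            · exact card_le_of_not_mem hT' h1 h
          omega)
    exact ⟨g, hg, fun e he f hf h => Or.inl (hg' e he f hf h)⟩
  · obtain ⟨a, ha1, ha3⟩ := Finset.not_disjoint_iff.1 hd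
    have cU : ((U.erase e1).erase e3).card + 2 ≤ U.card := by
      rw [Finset.card_erase_of_mem (Finset.mem_erase.2 ⟨h13.symm, h3'.1⟩),
        Finset.card_erase_of_mem h1'.1]
      have : 1 < U.card := Finset.one_lt_card.2 ⟨e1, h1'.1, e3, h3'.1, h13⟩
      omega
    have cP : (((U \ C).erase e1).erase e3).card + 2 ≤ (U \ C).card := by
      rw [Finset.card_erase_of_mem (Finset.mem_erase.2 ⟨h13.symm, h3⟩),
        Finset.card_erase_of_mem h1]
      have : 1 < (U \ C).card := Finset.one_lt_card.2 ⟨e1, h1, e3, h3, h13⟩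
      omega
    obtain ⟨g, hg, hg'⟩ := hall_aux ((U.erase e1).erase e3) (fun e => (A e).erase a) (by
      intro T hT hne
      left
      have hTU : T ⊆ U := hT.trans ((Finset.erase_subset _ _).trans (Finset.erase_subset _ _))
      by_cases hc : ∃ e ∈ T, e ∈ C
      · obtain ⟨e, he, heC⟩ := hc
        refine ⟨e, he, ?_⟩
        have := Finset.card_le_card hT
        have := hC e (hTU he) heC
        have := Finset.pred_card_le_card_erase (s := A e) (a := a)
        omega
      · push Not at hc
        have hT' : T ⊆ ((U \ C).erase e1).erase e3 := fun x hx => by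
          have h1 := hT hx
          have h2 := hc x hx
          simp at h1 ⊢
          tauto
        obtain ⟨e, he⟩ := hne
        refine ⟨e, he, ?_⟩
        have := Finset.card_le_card hT'
        have := hA e (hTU he) (hc e he)
        have := Finset.pred_card_le_card_erase (s := A e) (a := a)
        omega)
    have hg2 : ∀ e ∈ U, e ≠ e1 → e ≠ e3 → g e ∈ A e ∧ g e ≠ a := by
      intro e he h h'
      have := hg e (by simp [he, h, h'])
      simp at this
      tauto
    have hg3 : ∀ e ∈ U, e ≠ e1 → e ≠ e3 → ∀ f ∈ U, f ≠ e1 → f ≠ e3 → g e = g f → e = f := by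
      intro e he h h' f hf hf1 hf3 hh
      exact hg' e (by simp [he, h, h']) f (by simp [hf, hf1, hf3]) hh
    refine ⟨fun e => if e = e1 ∨ e = e3 then a else g e, ?_, ?_⟩
    · intro e he
      grind
    · intro e he f hf
      grind

theorem two_pair {α : Type*} [DecidableEq α] (U C : Finset α) (A : α → Finset ℕ)
    (hU : U.card ≤ 12) (hP : (U \ C).card ≤ 8)
    (hC : ∀ e ∈ U, e ∈ C → 10 ≤ (A e).card) (hA : ∀ e ∈ U, e ∉ C → 7 ≤ (A e).card)
    (e1 e3 e2 e4 : α) (h13 : e1 ≠ e3) (h1 : e1 ∈ U \ C) (h3 : e3 ∈ U \ C)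
    (h24 : e2 ≠ e4) (h2 : e2 ∈ U \ C) (h4 : e4 ∈ U \ C)
    (h12 : e1 ≠ e2) (h14 : e1 ≠ e4) (h32 : e3 ≠ e2) (h34 : e3 ≠ e4) 
    (hd : ¬ Disjoint (A e1) (A e3)) :
    ∃ g : α → ℕ, (∀ e ∈ U, g e ∈ A e) ∧ ∀ e ∈ U, ∀ f ∈ U, g e = g f →
      e = f ∨ (e = e1 ∧ f = e3) ∨ (e = e3 ∧ f = e1) ∨ (e = e2 ∧ f = e4) ∨ (e = e4 ∧ f = e2) := by
  have h1' := Finset.mem_sdiff.1 h1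
  have h3' := Finset.mem_sdiff.1 h3
  obtain ⟨a, ha1, ha3⟩ := Finset.not_disjoint_iff.1 hd
  have cU : ((U.erase e1).erase e3).card + 2 ≤ U.card := by
    rw [Finset.card_erase_of_mem (Finset.mem_erase.2 ⟨h13.symm, h3'.1⟩),
      Finset.card_erase_of_mem h1'.1]
    have : 1 < U.card := Finset.one_lt_card.2 ⟨e1, h1'.1, e3, h3'.1, h13⟩
    omega
  have cP : (((U \ C).erase e1).erase e3).card + 2 ≤ (U \ C).card := by
    rw [Finset.card_erase_of_mem (Finset.mem_erase.2 ⟨h13.symm, h3⟩),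
      Finset.card_erase_of_mem h1]
    have : 1 < (U \ C).card := Finset.one_lt_card.2 ⟨e1, h1, e3, h3, h13⟩
    omega
  have hPeq : ((U.erase e1).erase e3) \ C = ((U \ C).erase e1).erase e3 := by
    ext x
    simp
    tauto
  obtain ⟨g, hg, hg'⟩ := one_pair ((U.erase e1).erase e3) C (fun e => (A e).erase a) 9 6
    (by omega) (by rw [hPeq]; omega) (by omega)
    (by
      intro e he heC
      simp at he
      have := hC e he.2.2 heC
      have := Finset.pred_card_le_card_erase (s := A e) (a := a)
      omega)
    (by
      intro e he heC
      simp at he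
      have := hA e he.2.2 heC
      have := Finset.pred_card_le_card_erase (s := A e) (a := a)
      omega) e2 e4 h24 (by rw [hPeq]; simp at h2 ⊢; grind) (by rw [hPeq]; simp at h4 ⊢; grind)
  have hg2 : ∀ e ∈ U, e ≠ e1 → e ≠ e3 → g e ∈ A e ∧ g e ≠ a := by
    intro e he h h'
    have := hg e (by simp [he, h, h'])
    simp at this
    tauto
  have hg3 : ∀ e ∈ U, e ≠ e1 → e ≠ e3 → ∀ f ∈ U, f ≠ e1 → f ≠ e3 → g e = g f → 
      e = f ∨ (e = e2 ∧ f = e4) ∨ (e = e4 ∧ f = e2) := by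
    intro e he h h' f hf hf1 hf3 hh
    exact hg' e (by simp [he, h, h']) f (by simp [hf, hf1, hf3]) hh
  refine ⟨fun e => if e = e1 ∨ e = e3 then a else g e, ?_, ?_⟩
  · intro e he
    grind
  · intro e he f hf
    have k1 := hg3 e he
    have k2 := hg2 e he
    have k3 := hg2 f hf
    by_cases he1 : e = e1 ∨ e = e3 <;> by_cases hf1 : f = e1 ∨ f = e3 <;> simp only [he1, hf1, if_true, if_false]
    · grind
    · grind
    · grind
    · intro h
      have := k1 (by tauto) (by tauto) f hf (by tauto) (by tauto) h
      tauto

theorem two_pair' {α : Type*} [DecidableEq α] (U C : Finset α) (A : α → Finset ℕ)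
    (hU : U.card ≤ 12) (hP : (U \ C).card ≤ 8)
    (hC : ∀ e ∈ U, e ∈ C → 10 ≤ (A e).card) (hA : ∀ e ∈ U, e ∉ C → 7 ≤ (A e).card)
    (e1 e3 e2 e4 : α) (h13 : e1 ≠ e3) (h1 : e1 ∈ U \ C) (h3 : e3 ∈ U \ C)
    (h24 : e2 ≠ e4) (h2 : e2 ∈ U \ C) (h4 : e4 ∈ U \ C)
    (h12 : e1 ≠ e2) (h14 : e1 ≠ e4) (h32 : e3 ≠ e2) (h34 : e3 ≠ e4) :
    ∃ g : α → ℕ, (∀ e ∈ U, g e ∈ A e) ∧ ∀ e ∈ U, ∀ f ∈ U, g e = g f →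
      e = f ∨ (e = e1 ∧ f = e3) ∨ (e = e3 ∧ f = e1) ∨ (e = e2 ∧ f = e4) ∨ (e = e4 ∧ f = e2) := by
  by_cases hd : Disjoint (A e1) (A e3)
  swap
  · exact two_pair U C A hU hP hC hA e1 e3 e2 e4 h13 h1 h3 h24 h2 h4 h12 h14 h32 h34 hd
  by_cases hd' : Disjoint (A e2) (A e4)
  swap
  · obtain ⟨g, hg, hg'⟩ := two_pair U C A hU hP hC hA e2 e4 e1 e3 h24 h2 h4 h13 h1 h3
      h12.symm h32.symm h14.symm h34.symm hd'
    refine ⟨g, hg, fun e he f hf h => ?_⟩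
    have := hg' e he f hf h
    tauto
  have h1' := Finset.mem_sdiff.1 h1
  have h3' := Finset.mem_sdiff.1 h3
  have h2' := Finset.mem_sdiff.1 h2
  have h4' := Finset.mem_sdiff.1 h4
  have two : ∀ (T U : Finset α), T ⊆ U → e1 ∈ U → e2 ∈ U → e3 ∈ U → e4 ∈ U →
      ¬ (e1 ∈ T ∧ e3 ∈ T) → ¬ (e2 ∈ T ∧ e4 ∈ T) → T.card + 2 ≤ U.card := by
    intro T U hT k1 k2 k3 k4 n1 n2
    obtain ⟨x, hx, hxU, hxT⟩ : ∃ x, (x = e1 ∨ x = e3) ∧ x ∈ U ∧ x ∉ T := by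
      by_cases h : e1 ∈ T
      · exact ⟨e3, by simp, k3, fun h' => n1 ⟨h, h'⟩⟩
      · exact ⟨e1, by simp, k1, h⟩
    obtain ⟨y, hy, hyU, hyT⟩ : ∃ x, (x = e2 ∨ x = e4) ∧ x ∈ U ∧ x ∉ T := by
      by_cases h : e2 ∈ T
      · exact ⟨e4, by simp, k4, fun h' => n2 ⟨h, h'⟩⟩
      · exact ⟨e2, by simp, k2, h⟩
    have hxy : x ≠ y := by grind
    have := card_le_of_not_mem (T := T) (U := U.erase x) (e := y)
      (fun z hz => Finset.mem_erase.2 ⟨by rintro rfl; exact hxT hz, hT hz⟩)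
      (Finset.mem_erase.2 ⟨hxy.symm, hyU⟩) hyT
    rw [Finset.card_erase_of_mem hxU] at this
    omega
  obtain ⟨g, hg, hg'⟩ := hall_aux U A (by
    intro T hT hne
    have hcard := Finset.card_le_card hT
    by_cases hb : e1 ∈ T ∧ e3 ∈ T
    · right
      refine ⟨e1, hb.1, e3, hb.2, hd, ?_⟩
      have a1 := hA e1 h1'.1 h1'.2
      have a3 := hA e3 h3'.1 h3'.2
      omega
    by_cases hb' : e2 ∈ T ∧ e4 ∈ T
    · right
      refine ⟨e2, hb'.1, e4, hb'.2, hd', ?_⟩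
      have a1 := hA e2 h2'.1 h2'.2
      have a3 := hA e4 h4'.1 h4'.2
      omega
    left
    by_cases hc : ∃ e ∈ T, e ∈ C
    · obtain ⟨e, he, heC⟩ := hc
      refine ⟨e, he, le_trans ?_ (hC e (hT he) heC)⟩
      have := two T U hT h1'.1 h2'.1 h3'.1 h4'.1 hb hb'
      omega
    · push Not at hc
      have hT' : T ⊆ U \ C := fun x hx => Finset.mem_sdiff.2 ⟨hT hx, hc x hx⟩
      obtain ⟨e, he⟩ := hne
      refine ⟨e, he, le_trans ?_ (hA e (hT he) (hc e he))⟩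
      have := two T (U \ C) hT' h1 h2 h3 h4 hb hb'
      omega)
  exact ⟨g, hg, fun e he f hf h => Or.inl (hg' e he f hf h)⟩

variable {V : Type*} [Fintype V] [DecidableEq V] (G : SimpleGraph V) [DecidableRel G.Adj]

/-- edges meeting `S` -/
def UU (S : Finset V) : Finset (Sym2 V) :=
  S.biUnion fun v => (G.neighborFinset v).image (fun w => s(v, w))

/-- edges at `x` with other end outside `S` -/
def outE (S : Finset V) (x : V) : Finset (Sym2 V) :=
  (G.neighborFinset x \ S).image (fun w => s(x, w))

theorem mem_UU (S : Finset V) (u v : V) : s(u, v) ∈ UU G S ↔ G.Adj u v ∧ (u ∈ S ∨ v ∈ S) := by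
  simp only [UU, Finset.mem_biUnion, Finset.mem_image, SimpleGraph.mem_neighborFinset, Sym2.eq_iff]
  constructor
  · rintro ⟨x, hx, w, hw, ⟨rfl, rfl⟩ | ⟨rfl, rfl⟩⟩
    · exact ⟨hw, Or.inl hx⟩
    · exact ⟨hw.symm, Or.inr hx⟩
  · rintro ⟨h, hu | hv⟩
    · exact ⟨u, hu, v, h, Or.inl ⟨rfl, rfl⟩⟩
    · exact ⟨v, hv, u, h.symm, Or.inr ⟨rfl, rfl⟩⟩

def ExtP : Prop := ∀ S : Finset V, (UU G S).Nonempty → ∃ A : Sym2 V → Finset ℕ,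
  (∀ e ∈ UU G S, ∀ K : Finset (Sym2 V), 
    (∀ f ∈ G.edgeSet, f ∉ UU G S → EdgeClose G e f → f ∈ K) → 22 ≤ (A e).card + K.card) ∧
  ∀ g : Sym2 V → ℕ, (∀ e ∈ UU G S, g e ∈ A e) →
    ∃ e ∈ UU G S, ∃ f ∈ UU G S, g e = g f ∧ e ≠ f ∧ EdgeClose G e f

theorem extP (L : Sym2 V → Finset ℕ) (hL : ∀ e ∈ G.edgeSet, 22 ≤ (L e).card)
    (hG : ¬ StronglyLColorable G L)
    (hmin : ∀ H : SimpleGraph V, H < G → StronglyLColorable H L) : ExtP G := by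
  classical
  intro S hS
  have hUE : ∀ e ∈ UU G S, e ∈ G.edgeSet := by
    intro e
    induction e with
    | _ u v => rw [mem_UU]; exact fun h => h.1
  let H : SimpleGraph V := G.deleteEdges (UU G S : Set (Sym2 V))
  have hHe : ∀ e, e ∈ H.edgeSet ↔ e ∈ G.edgeSet ∧ e ∉ UU G S := by
    intro e
    simp [H, SimpleGraph.edgeSet_deleteEdges]
  have hle : H ≤ G := SimpleGraph.deleteEdges_le _
  have hlt : H < G := by
    refine lt_of_le_of_ne hle fun h => ?_
    obtain ⟨e, he⟩ := hS
    have h1 := hUE e he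
    rw [← h] at h1
    exact ((hHe e).1 h1).2 he
  obtain ⟨c, hc, hcL⟩ := hmin H hlt
  have hclose : ∀ e ∈ H.edgeSet, ∀ f ∈ H.edgeSet, EdgeClose G e f → EdgeClose H e f := by
    rintro e he f hf ⟨u, w, hu, hw, h⟩
    refine ⟨u, w, hu, hw, ?_⟩
    rcases h with h | h
    · exact Or.inl h
    right
    obtain ⟨u', rfl⟩ := Sym2.mem_iff_exists.1 hu
    obtain ⟨w', rfl⟩ := Sym2.mem_iff_exists.1 hw
    rw [hHe, mem_UU] at he hf
    have he1 : G.Adj u u' := he.1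
    have hf1 : G.Adj w w' := hf.1
    have : s(u, w) ∈ H.edgeSet := by
      rw [hHe, mem_UU]
      refine ⟨h, ?_⟩
      tauto
    exact this
  let Q : Sym2 V → Finset (Sym2 V) := fun e =>
    Finset.univ.filter (fun f => f ∈ G.edgeSet ∧ f ∉ UU G S ∧ EdgeClose G e f)
  refine ⟨fun e => L e \ (Q e).image c, ?_, ?_⟩
  · intro e he K hK
    have h1 : Q e ⊆ K := by
      intro f hf
      simp only [Q, Finset.mem_filter] at hf
      exact hK f hf.2.1 hf.2.2.1 hf.2.2.2
    have h2 := hL e (hUE e he)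
    have h3 := Finset.le_card_sdiff ((Q e).image c) (L e)
    have h4 := Finset.card_le_card h1
    have h5 : ((Q e).image c).card ≤ (Q e).card := Finset.card_image_le
    show 22 ≤ (L e \ (Q e).image c).card + K.card
    omega
  · intro g hg
    by_contra hcon
    push Not at hcon
    have hsymm : ∀ e f, EdgeClose G e f → EdgeClose G f e := by
      rintro e f ⟨u, w, hu, hw, h⟩
      exact ⟨w, u, hw, hu, h.imp Eq.symm (fun h => h.symm)⟩
    have hmix : ∀ e ∈ UU G S, ∀ f ∈ G.edgeSet, f ∉ UU G S → EdgeClose G e f → g e ≠ c f := by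
      intro e he f hf hfU hcl heq
      have := (Finset.mem_sdiff.1 (hg e he)).2
      apply this
      rw [heq]
      exact Finset.mem_image_of_mem _ (by simp only [Q, Finset.mem_filter]; exact ⟨Finset.mem_univ _, hf, hfU, hcl⟩)
    refine hG ⟨fun e => if e ∈ UU G S then g e else c e, ?_, ?_⟩
    · intro e he f hf hne hcl
      by_cases h1 : e ∈ UU G S <;> by_cases h2 : f ∈ UU G S <;> simp only [h1, h2, if_true, if_false]
      · exact fun h => hcon e h1 f h2 h hne hcl
      · exact hmix e h1 f hf h2 hcl
      · exact (hmix f h2 e he h1 (hsymm _ _ hcl)).symm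
      · exact hc e ((hHe e).2 ⟨he, h1⟩) f ((hHe f).2 ⟨hf, h2⟩) hne
          (hclose e ((hHe e).2 ⟨he, h1⟩) f ((hHe f).2 ⟨hf, h2⟩) hcl)
    · intro e he
      by_cases h1 : e ∈ UU G S <;> simp only [h1, if_true, if_false]
      · exact (Finset.mem_sdiff.1 (hg e h1)).1
      · exact hcL e ((hHe e).2 ⟨he, h1⟩)

theorem mem_outE (S : Finset V) (x y : V) (h : G.Adj x y) (hy : y ∉ S) : s(x, y) ∈ outE G S x := by
  simp only [outE, Finset.mem_image, Finset.mem_sdiff, SimpleGraph.mem_neighborFinset]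
  exact ⟨y, ⟨h, hy⟩, rfl⟩

/-- a neighbourhood bound: `X` are distinct neighbours of `x` in `S` -/
theorem card_out_nbr (hΔ : ∀ u, G.degree u ≤ 4) (S X : Finset V) (x : V) 
    (hX : ∀ v ∈ X, v ∈ S ∧ G.Adj x v) : (G.neighborFinset x \ S).card + X.card ≤ 4 := by
  have h1 : (G.neighborFinset x).card ≤ 4 := by
    rw [SimpleGraph.card_neighborFinset_eq_degree]; exact hΔ x
  have h2 : Disjoint (G.neighborFinset x \ S) X := by
    rw [Finset.disjoint_left]
    intro a ha haX
    exact (Finset.mem_sdiff.1 ha).2 (hX a haX).1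
  rw [← Finset.card_union_of_disjoint h2]
  refine (Finset.card_le_card (Finset.union_subset Finset.sdiff_subset ?_)).trans h1
  intro v hv
  simpa using (hX v hv).2

theorem card_outE (S : Finset V) (x : V) : (outE G S x).card ≤ (G.neighborFinset x \ S).card :=
  Finset.card_image_le

theorem pend_bound (hΔ : ∀ u, G.degree u ≤ 4) (S : Finset V) (u a : V) (hu : u ∈ S) (ha : a ∉ S)
    (hua : G.Adj u a) (k l : ℕ) (hk : (G.neighborFinset u \ S).card ≤ k + 1)
    (hl : (G.neighborFinset a \ S).card ≤ l) :
    ∃ K : Finset (Sym2 V), K.card ≤ 3 * k + 4 * l ∧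
      (∀ f ∈ G.edgeSet, f ∉ UU G S → EdgeClose G s(u, a) f → f ∈ K) := by
  refine ⟨((G.neighborFinset u \ S).erase a).biUnion (outE G S) ∪ 
    (G.neighborFinset a \ S).biUnion (outE G S), ?_, ?_⟩
  · have h1 : (((G.neighborFinset u \ S).erase a).biUnion (outE G S)).card ≤ 
        ((G.neighborFinset u \ S).erase a).card * 3 := by
      apply Finset.card_biUnion_le_card_mul
      intro x hx
      simp at hx
      have := card_out_nbr G hΔ S {u} x (by simp [hu, hx.2.1.symm])
      have := card_outE G S x
      simp at *
      omega
    have h2 : ((G.neighborFinset a \ S).biUnion (outE G S)).card ≤ 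
        (G.neighborFinset a \ S).card * 4 := by
      apply Finset.card_biUnion_le_card_mul
      intro x hx
      have := card_out_nbr G hΔ S ∅ x (by simp)
      have := card_outE G S x
      simp at *
      omega
    have h3 : ((G.neighborFinset u \ S).erase a).card + 1 = (G.neighborFinset u \ S).card :=
      Finset.card_erase_add_one (by simp [hua, ha])
    have h4 := Finset.card_union_le (((G.neighborFinset u \ S).erase a).biUnion (outE G S)) 
      ((G.neighborFinset a \ S).biUnion (outE G S))
    omega
  · rintro f hf hfU ⟨t, p, ht, hp, htp⟩
    obtain ⟨q, rfl⟩ := Sym2.mem_iff_exists.1 hp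
    have hpq : G.Adj p q := hf
    rw [mem_UU] at hfU
    have hpS : p ∉ S := by tauto
    have hqS : q ∉ S := by tauto
    simp only [Finset.mem_union, Finset.mem_biUnion, Finset.mem_sdiff, Finset.mem_erase, 
      SimpleGraph.mem_neighborFinset]
    have hpa : p = a → s(p, q) ∈ outE G S q ∧ G.Adj a q := by
      rintro rfl
      rw [Sym2.eq_swap]
      exact ⟨mem_outE G S q p hpq.symm hpS, hpq⟩
    have hpo := mem_outE G S p q hpq hqS
    rw [Sym2.mem_iff] at ht
    by_cases hpa' : p = a
    · right
      exact ⟨q, ⟨(hpa hpa').2, hqS⟩, (hpa hpa').1⟩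
    rcases ht with rfl | rfl
    · left
      rcases htp with rfl | h
      · exact absurd hu hpS
      · exact ⟨p, ⟨hpa', h, hpS⟩, hpo⟩
    · right
      rcases htp with rfl | h
      · exact absurd rfl hpa'
      · exact ⟨p, ⟨h, hpS⟩, hpo⟩

/-- bound for an inner edge; `Z` are outside neighbours with two neighbours in `S` -/
theorem inner_bound (hΔ : ∀ u, G.degree u ≤ 4) (S Z : Finset V) (u v : V) (hu : u ∈ S) (hv : v ∈ S)
    (hku : (G.neighborFinset u \ S).card ≤ 2) (hkv : (G.neighborFinset v \ S).card ≤ 2)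
    (hZ : ∀ z ∈ Z, z ∉ S ∧ (G.Adj u z ∨ G.Adj v z) ∧ (G.neighborFinset z \ S).card ≤ 2) :
    ∃ K : Finset (Sym2 V), K.card + Z.card ≤ 12 ∧
      (∀ f ∈ G.edgeSet, f ∉ UU G S → EdgeClose G s(u, v) f → f ∈ K) := by
  let X := (G.neighborFinset u \ S) ∪ (G.neighborFinset v \ S)
  have hX4 : X.card ≤ 4 := (Finset.card_union_le _ _).trans (by omega)
  have hZX : Z ⊆ X := by
    intro z hz
    have := hZ z hz
    simp [X]
    tauto
  refine ⟨(X \ Z).biUnion (outE G S) ∪ Z.biUnion (outE G S), ?_, ?_⟩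
  · have h1 : ((X \ Z).biUnion (outE G S)).card ≤ (X \ Z).card * 3 := by
      apply Finset.card_biUnion_le_card_mul
      intro x hx
      have hx' : G.Adj u x ∨ G.Adj v x := by
        simp [X] at hx
        tauto
      have := card_outE G S x
      rcases hx' with h | h
      · have := card_out_nbr G hΔ S {u} x (by simp [hu, h.symm])
        simp at this
        omega
      · have := card_out_nbr G hΔ S {v} x (by simp [hv, h.symm])
        simp at this
        omega
    have h2 : (Z.biUnion (outE G S)).card ≤ Z.card * 2 := by
      apply Finset.card_biUnion_le_card_mul
      intro x hx
      exact (card_outE G S x).trans (hZ x hx).2.2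
    have h3 := Finset.card_sdiff_add_card_eq_card hZX
    have h4 := Finset.card_union_le ((X \ Z).biUnion (outE G S)) (Z.biUnion (outE G S))
    omega
  · rintro f hf hfU ⟨t, p, ht, hp, htp⟩
    obtain ⟨q, rfl⟩ := Sym2.mem_iff_exists.1 hp
    have hpq : G.Adj p q := hf
    rw [mem_UU] at hfU
    have hpS : p ∉ S := by tauto
    have hqS : q ∉ S := by tauto
    have hpo := mem_outE G S p q hpq hqS
    rw [Sym2.mem_iff] at ht
    have htS : t ∈ S := by rcases ht with rfl | rfl <;> assumption
    have hpX : p ∈ X := by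
      rcases htp with rfl | h
      · exact absurd htS hpS
      · simp only [X, Finset.mem_union, Finset.mem_sdiff, SimpleGraph.mem_neighborFinset]
        rcases ht with rfl | rfl <;> tauto
    simp only [Finset.mem_union, Finset.mem_biUnion]
    by_cases hpZ : p ∈ Z
    · exact Or.inr ⟨p, hpZ, hpo⟩
    · exact Or.inl ⟨p, Finset.mem_sdiff.2 ⟨hpX, hpZ⟩, hpo⟩

/-- pendant edges count -/
theorem card_pend (S : Finset V) (C : Finset (Sym2 V)) (n k : ℕ) (hS : S.card ≤ n)
    (hk : ∀ v ∈ S, (G.neighborFinset v \ S).card ≤ k)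
    (hC : ∀ u ∈ S, ∀ v ∈ S, G.Adj u v → s(u, v) ∈ C) : 
    (UU G S \ C).card ≤ n * k ∧ 
    ∀ e ∈ UU G S, e ∉ C → ∃ u a, u ∈ S ∧ a ∉ S ∧ G.Adj u a ∧ e = s(u, a) := by
  have key : ∀ e ∈ UU G S, e ∉ C → ∃ u a, u ∈ S ∧ a ∉ S ∧ G.Adj u a ∧ e = s(u, a) := by
    intro e
    induction e with
    | _ u v =>
      rw [mem_UU]
      rintro ⟨h, h'⟩ hc
      by_cases hu : u ∈ S
      · by_cases hv : v ∈ S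
        · exact absurd (hC u hu v hv h) hc
        · exact ⟨u, v, hu, hv, h, rfl⟩
      · exact ⟨v, u, by tauto, hu, h.symm, Sym2.eq_swap⟩
  refine ⟨?_, key⟩
  have : UU G S \ C ⊆ S.biUnion (outE G S) := by
    intro e he
    obtain ⟨u, a, hu, ha, h, rfl⟩ := key e (Finset.mem_sdiff.1 he).1 (Finset.mem_sdiff.1 he).2
    exact Finset.mem_biUnion.2 ⟨u, hu, mem_outE G S u a h ha⟩
  refine (Finset.card_le_card this).trans ((Finset.card_biUnion_le_card_mul _ _ k ?_).trans
    (Nat.mul_le_mul_right _ hS))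
  intro v hv
  exact (card_outE G S v).trans (hk v hv)

theorem deg_four (hΔ : ∀ u, G.degree u ≤ 4) (hE : ExtP G) (v w : V) (hvw : G.Adj v w) :
    4 ≤ G.degree v := by
  by_contra hlt
  have hv : (G.neighborFinset v \ {v}).card ≤ 3 := by
    have h1 := Finset.card_le_card (Finset.sdiff_subset (s := G.neighborFinset v) (t := {v}))
    rw [SimpleGraph.card_neighborFinset_eq_degree] at h1
    omega
  obtain ⟨A, hA, hA'⟩ := hE {v} ⟨s(v, w), by rw [mem_UU]; simp [hvw]⟩
  obtain ⟨hc, hcl⟩ := card_pend G {v} ∅ 1 3 (by simp) (by simpa using hv) (by simp)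
  rw [Finset.sdiff_empty] at hc
  obtain ⟨g, hg, hg'⟩ := hall_aux (UU G {v}) A (by
    intro T hT ⟨e, he⟩
    refine Or.inl ⟨e, he, ?_⟩
    have h1 := Finset.card_le_card hT
    obtain ⟨u, a, hu, ha, hua, rfl⟩ := hcl e (hT he) (by simp)
    have h2 := card_out_nbr G hΔ {v} {u} a (by simp at hu ⊢; exact ⟨hu, hua.symm⟩)
    simp only [Finset.card_singleton] at h2
    obtain ⟨K, hK, hK'⟩ := pend_bound G hΔ {v} u a hu ha hua 2 3 
      (by rw [Finset.mem_singleton.1 hu]; exact hv) (by omega)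
    have := hA _ (hT he) K hK'
    omega)
  obtain ⟨e, he, f, hf, h, hne, -⟩ := hA' g hg
  exact hne (hg' e he f hf h)

theorem pend15 (hΔ : ∀ u, G.degree u ≤ 4) (S : Finset V) (u a : V) (hu : u ∈ S) (ha : a ∉ S)
    (hua : G.Adj u a) (hk : (G.neighborFinset u \ S).card ≤ 2) :
    ∃ K : Finset (Sym2 V), K.card ≤ 15 ∧
      (∀ f ∈ G.edgeSet, f ∉ UU G S → EdgeClose G s(u, a) f → f ∈ K) := by
  have h2 := card_out_nbr G hΔ S {u} a (by simp; exact ⟨hu, hua.symm⟩)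
  simp only [Finset.card_singleton] at h2
  exact pend_bound G hΔ S u a hu ha hua 1 3 hk (by omega)

theorem no_triangle (hΔ : ∀ u, G.degree u ≤ 4) (hE : ExtP G) (x y w : V) (hxy : G.Adj x y)
    (hyw : G.Adj y w) (hxw : G.Adj x w) : False := by
  let S : Finset V := {x, y, w}
  let C : Finset (Sym2 V) := {s(x, y), s(y, w), s(x, w)}
  have hS : ∀ v ∈ S, (G.neighborFinset v \ S).card ≤ 2 := by
    intro v hv
    simp only [S, Finset.mem_insert, Finset.mem_singleton] at hv
    rcases hv with rfl | rfl | rfl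
    · have := card_out_nbr G hΔ S {y, w} v (by simp [S, hxy, hxw])
      rw [Finset.card_pair hyw.ne] at this
      omega
    · have := card_out_nbr G hΔ S {x, w} v (by simp [S, hxy.symm, hyw])
      rw [Finset.card_pair hxw.ne] at this
      omega
    · have := card_out_nbr G hΔ S {x, y} v (by simp [S, hyw.symm, hxw.symm])
      rw [Finset.card_pair hxy.ne] at this
      omega
  have hC : ∀ u ∈ S, ∀ v ∈ S, G.Adj u v → s(u, v) ∈ C := by
    intro u hu v hv huv
    have := huv.ne
    simp only [S, Finset.mem_insert, Finset.mem_singleton] at hu hv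
    simp only [C, Finset.mem_insert, Finset.mem_singleton, Sym2.eq_iff]
    rcases hu with rfl | rfl | rfl <;> rcases hv with rfl | rfl | rfl <;> simp_all
  have hCS : ∀ e ∈ C, ∃ u v, u ∈ S ∧ v ∈ S ∧ e = s(u, v) := by
    intro e he
    simp only [C, Finset.mem_insert, Finset.mem_singleton] at he
    rcases he with rfl | rfl | rfl
    · exact ⟨x, y, by simp [S], by simp [S], rfl⟩
    · exact ⟨y, w, by simp [S], by simp [S], rfl⟩
    · exact ⟨x, w, by simp [S], by simp [S], rfl⟩
  have hC3 : C.card ≤ 3 := Finset.card_le_three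
  obtain ⟨A, hA, hA'⟩ := hE S ⟨s(x, y), by rw [mem_UU]; simp [S, hxy]⟩
  obtain ⟨hc, hcl⟩ := card_pend G S C 3 2 Finset.card_le_three hS hC
  have hU : (UU G S).card ≤ 9 := by
    have h1 := Finset.le_card_sdiff C (UU G S)
    omega
  obtain ⟨g, hg, hg'⟩ := hall_aux (UU G S) A (by
    intro T hT hne
    left
    by_cases hTC : ∃ e ∈ T, e ∈ C
    · obtain ⟨e, he, heC⟩ := hTC
      refine ⟨e, he, ?_⟩
      obtain ⟨u, v, hu, hv, rfl⟩ := hCS e heC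
      obtain ⟨K, hK, hK'⟩ := inner_bound G hΔ S ∅ u v hu hv (hS u hu) (hS v hv) (by simp)
      have := hA _ (hT he) K hK'
      have := Finset.card_le_card hT
      omega
    · push Not at hTC
      obtain ⟨e, he⟩ := hne
      refine ⟨e, he, ?_⟩
      have h1 : T ⊆ UU G S \ C := fun x hx => Finset.mem_sdiff.2 ⟨hT hx, hTC x hx⟩
      have := Finset.card_le_card h1
      obtain ⟨u, a, hu, ha, hua, rfl⟩ := hcl e (hT he) (hTC e he)
      obtain ⟨K, hK, hK'⟩ := pend15 G hΔ S u a hu ha hua (hS u hu)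
      have := hA _ (hT he) K hK'
      omega)
  obtain ⟨e, he, f, hf, h, hne, -⟩ := hA' g hg
  exact hne (hg' e he f hf h)

/-- four-cycle -/
structure C4 (a b c d : V) : Prop where
  ab : G.Adj a b
  bc : G.Adj b c
  cd : G.Adj c d
  da : G.Adj d a
  ac : a ≠ c
  bd : b ≠ d
  nac : ¬ G.Adj a c
  nbd : ¬ G.Adj b d

def SS (a b c d : V) : Finset V := {a, b, c, d}
def CC (a b c d : V) : Finset (Sym2 V) := {s(a, b), s(b, c), s(c, d), s(d, a)}

theorem c4_data (hΔ : ∀ u, G.degree u ≤ 4) (hE : ExtP G) (a b c d : V) (h : C4 G a b c d) :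
    (∀ v ∈ SS a b c d, (G.neighborFinset v \ SS a b c d).card ≤ 2) ∧
    (UU G (SS a b c d)).card ≤ 12 ∧ (UU G (SS a b c d) \ CC a b c d).card ≤ 8 ∧
    ∃ A : Sym2 V → Finset ℕ,
    (∀ e ∈ UU G (SS a b c d), ∀ K : Finset (Sym2 V), 
      (∀ f ∈ G.edgeSet, f ∉ UU G (SS a b c d) → EdgeClose G e f → f ∈ K) → 
        22 ≤ (A e).card + K.card) ∧
    (∀ Z : Finset V, (∀ z ∈ Z, z ∉ SS a b c d ∧ 
        (G.Adj a z ∧ G.Adj c z ∨ G.Adj b z ∧ G.Adj d z)) → 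
      ∀ e ∈ UU G (SS a b c d), e ∈ CC a b c d → 10 + Z.card ≤ (A e).card) ∧
    (∀ e ∈ UU G (SS a b c d), e ∉ CC a b c d → 7 ≤ (A e).card) ∧
    ∀ g : Sym2 V → ℕ, (∀ e ∈ UU G (SS a b c d), g e ∈ A e) →
      ∃ e ∈ UU G (SS a b c d), ∃ f ∈ UU G (SS a b c d), g e = g f ∧ e ≠ f ∧ EdgeClose G e f := by
  obtain ⟨ab, bc, cd, da, ac, bd, nac, nbd⟩ := h
  set S := SS a b c d with hSdef
  set C := CC a b c d with hCdef
  have hS : ∀ v ∈ S, (G.neighborFinset v \ S).card ≤ 2 := by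
    intro v hv
    simp only [S, SS, Finset.mem_insert, Finset.mem_singleton] at hv
    rcases hv with rfl | rfl | rfl | rfl
    · have := card_out_nbr G hΔ S {b, d} v (by simp [S, SS, ab, da.symm])
      rw [Finset.card_pair bd] at this
      omega
    · have := card_out_nbr G hΔ S {a, c} v (by simp [S, SS, ab.symm, bc])
      rw [Finset.card_pair ac] at this
      omega
    · have := card_out_nbr G hΔ S {b, d} v (by simp [S, SS, bc.symm, cd])
      rw [Finset.card_pair bd] at this
      omega
    · have := card_out_nbr G hΔ S {a, c} v (by simp [S, SS, da, cd.symm])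
      rw [Finset.card_pair ac] at this
      omega
  have hC : ∀ u ∈ S, ∀ v ∈ S, G.Adj u v → s(u, v) ∈ C := by
    intro u hu v hv huv
    have := huv.ne
    have := huv.symm
    simp only [S, SS, Finset.mem_insert, Finset.mem_singleton] at hu hv
    simp only [C, CC, Finset.mem_insert, Finset.mem_singleton, Sym2.eq_iff]
    rcases hu with rfl | rfl | rfl | rfl <;> rcases hv with rfl | rfl | rfl | rfl <;> simp_all
  have hCS : ∀ e ∈ C, ∃ u v, u ∈ S ∧ v ∈ S ∧ e = s(u, v) ∧ (u = a ∨ u = c) ∧ (v = b ∨ v = d) := by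
    intro e he
    simp only [C, CC, Finset.mem_insert, Finset.mem_singleton] at he
    rcases he with rfl | rfl | rfl | rfl
    · exact ⟨a, b, by simp [S, SS], by simp [S, SS], rfl, by simp, by simp⟩
    · exact ⟨c, b, by simp [S, SS], by simp [S, SS], Sym2.eq_swap, by simp, by simp⟩
    · exact ⟨c, d, by simp [S, SS], by simp [S, SS], rfl, by simp, by simp⟩
    · exact ⟨a, d, by simp [S, SS], by simp [S, SS], Sym2.eq_swap, by simp, by simp⟩
  have hC3 : C.card ≤ 4 := Finset.card_le_four
  obtain ⟨A, hA, hA'⟩ := hE S ⟨s(a, b), by rw [mem_UU]; simp [S, SS, ab]⟩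
  obtain ⟨hc, hcl⟩ := card_pend G S C 4 2 Finset.card_le_four hS hC
  have hU : (UU G S).card ≤ 12 := by
    have h1 := Finset.le_card_sdiff C (UU G S)
    omega
  refine ⟨hS, hU, hc, A, hA, ?_, ?_, hA'⟩
  · intro Z hZ e he heC
    obtain ⟨u, v, hu, hv, rfl, hu', hv'⟩ := hCS e heC
    obtain ⟨K, hK, hK'⟩ := inner_bound G hΔ S Z u v hu hv (hS u hu) (hS v hv) (by
      intro z hz
      obtain ⟨h1, h2⟩ := hZ z hz
      refine ⟨h1, ?_, ?_⟩
      · rcases hu' with rfl | rfl <;> rcases hv' with rfl | rfl <;> tauto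
      · rcases h2 with h2 | h2
        · have := card_out_nbr G hΔ S {a, c} z (by simp [S, SS, h2.1.symm, h2.2.symm])
          rw [Finset.card_pair ac] at this
          omega
        · have := card_out_nbr G hΔ S {b, d} z (by simp [S, SS, h2.1.symm, h2.2.symm])
          rw [Finset.card_pair bd] at this
          omega)
    have := hA _ he K hK'
    omega
  · intro e he heC
    obtain ⟨u, x, hu, hx, hux, rfl⟩ := hcl e he heC
    obtain ⟨K, hK, hK'⟩ := pend15 G hΔ S u x hu hx hux (hS u hu)
    have := hA _ he K hK'
    omega

theorem pend_mem (a b c d u x : V) (hu : u ∈ SS a b c d) (hx : x ∉ SS a b c d) (h : G.Adj u x) :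
    s(u, x) ∈ UU G (SS a b c d) \ CC a b c d := by
  rw [Finset.mem_sdiff, mem_UU]
  refine ⟨⟨h, Or.inl hu⟩, ?_⟩
  simp only [SS, Finset.mem_insert, Finset.mem_singleton] at hx
  simp only [CC, Finset.mem_insert, Finset.mem_singleton, Sym2.eq_iff]
  tauto

/-- `z` joined to `a, c` and `w` joined to `b, d` impossible -/
theorem k23a (hΔ : ∀ u, G.degree u ≤ 4) (hE : ExtP G) (a b c d z w : V) (h : C4 G a b c d)
    (hz : z ∉ SS a b c d) (hw : w ∉ SS a b c d) (haz : G.Adj a z) (hcz : G.Adj c z)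
    (hbw : G.Adj b w) (hdw : G.Adj d w) : False := by
  have hzw : z ≠ w := by
    rintro rfl
    exact no_triangle G hΔ hE a b z h.ab hbw haz
  obtain ⟨hS, hU, hP, A, hA, hC, hA7, hA'⟩ := c4_data G hΔ hE a b c d h
  have hC := hC {z, w} (by
    intro x hx
    simp only [Finset.mem_insert, Finset.mem_singleton] at hx
    rcases hx with rfl | rfl
    · exact ⟨hz, Or.inl ⟨haz, hcz⟩⟩
    · exact ⟨hw, Or.inr ⟨hbw, hdw⟩⟩)
  rw [Finset.card_pair hzw] at hC
  have haS : a ∈ SS a b c d := by simp [SS]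
  have hsp := pend_mem G a b c d a z haS hz haz
  have h11 : 11 ≤ (A s(a, z)).card := by
    have := card_out_nbr G hΔ (SS a b c d) {a, c} z (by simp [SS, haz.symm, hcz.symm])
    rw [Finset.card_pair h.ac] at this
    obtain ⟨K, hK, hK'⟩ := pend_bound G hΔ (SS a b c d) a z haS hz haz 1 2 (hS a haS) (by omega)
    have := hA _ (Finset.mem_sdiff.1 hsp).1 K hK'
    omega
  obtain ⟨g, hg, hg'⟩ := hall_aux (UU G (SS a b c d)) A (by
    intro T hT hne
    left
    by_cases hTC : ∃ e ∈ T, e ∈ CC a b c d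
    · obtain ⟨e, he, heC⟩ := hTC
      refine ⟨e, he, ?_⟩
      have := hC e (hT he) heC
      have := Finset.card_le_card hT
      omega
    · push Not at hTC
      have h1 : T ⊆ UU G (SS a b c d) \ CC a b c d := 
        fun x hx => Finset.mem_sdiff.2 ⟨hT hx, hTC x hx⟩
      have := Finset.card_le_card h1
      by_cases hm : s(a, z) ∈ T
      · exact ⟨_, hm, by omega⟩
      obtain ⟨e, he⟩ := hne
      refine ⟨e, he, ?_⟩
      have := card_le_of_not_mem h1 hsp hm
      have := hA7 e (hT he) (hTC e he)
      omega)
  obtain ⟨e, he, f, hf, h, hne, -⟩ := hA' g hg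
  exact hne (hg' e he f hf h)

theorem close_comm (e f : Sym2 V) (h : EdgeClose G e f) : EdgeClose G f e := by
  obtain ⟨u, w, hu, hw, h⟩ := h
  exact ⟨w, u, hw, hu, h.imp Eq.symm (fun h => h.symm)⟩

/-- `z` joined to `a, c`; ends of pendants at `b, d` are adjacent -/
theorem k23b (hΔ : ∀ u, G.degree u ≤ 4) (hE : ExtP G) (a b c d z x y : V) (h : C4 G a b c d)
    (hz : z ∉ SS a b c d) (hx : x ∉ SS a b c d) (hy : y ∉ SS a b c d)
    (haz : G.Adj a z) (hcz : G.Adj c z)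
    (hbx : G.Adj b x) (hdy : G.Adj d y) : G.Adj x y := by
  by_contra hxy
  have hdx : ¬ G.Adj d x := fun h' => k23a G hΔ hE a b c d z x h hz hx haz hcz hbx h'
  have hby : ¬ G.Adj b y := fun h' => k23a G hΔ hE a b c d z y h hz hy haz hcz h' hdy
  have hxy' : x ≠ y := by rintro rfl; exact hdx hdy
  obtain ⟨hS, hU, hP, A, hA, hC, hA7, hA'⟩ := c4_data G hΔ hE a b c d h
  have hC := hC {z} (by
    intro x hx
    simp only [Finset.mem_singleton] at hx
    subst hx
    exact ⟨hz, Or.inl ⟨haz, hcz⟩⟩)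
  rw [Finset.card_singleton] at hC
  have hm1 := pend_mem G a b c d b x (by simp [SS]) hx hbx
  have hm2 := pend_mem G a b c d d y (by simp [SS]) hy hdy
  have hbS : b ∈ SS a b c d := by simp [SS]
  have hdS : d ∈ SS a b c d := by simp [SS]
  have hncl : ¬ EdgeClose G s(b, x) s(d, y) := by
    rintro ⟨u, v, hu, hv, huv⟩
    rw [Sym2.mem_iff] at hu hv
    have h1 := h.bd
    have h2 := h.nbd
    rcases hu with rfl | rfl <;> rcases hv with rfl | rfl <;> rcases huv with huv | huv
    · exact h1 huv
    · exact h2 huv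
    · exact hy (huv ▸ hbS)
    · exact hby huv
    · exact hx (huv ▸ hdS)
    · exact hdx huv.symm
    · exact hxy' huv
    · exact hxy huv
  obtain ⟨g, hg, hg'⟩ := one_pair (UU G (SS a b c d)) (CC a b c d) A 11 7 hU hP (by omega) hC hA7
    s(b, x) s(d, y) (by
      intro h'
      rw [Sym2.eq_iff] at h'
      have := h.bd
      have : x ≠ d := by rintro rfl; exact hx hdS
      tauto) hm1 hm2
  obtain ⟨e, he, f, hf, h', hne, hcl⟩ := hA' g hg
  rcases hg' e he f hf h' with h1 | ⟨rfl, rfl⟩ | ⟨rfl, rfl⟩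
  · exact hne h1
  · exact hncl hcl
  · exact hncl (close_comm G _ _ hcl)

theorem exists_nbr (hΔ : ∀ u, G.degree u ≤ 4) (hE : ExtP G) (v w : V) (hvw : G.Adj v w) 
    (X : Finset V) (hX : X.card ≤ 3) : ∃ x, G.Adj v x ∧ x ∉ X := by
  have h1 := deg_four G hΔ hE v w hvw
  rw [← SimpleGraph.card_neighborFinset_eq_degree] at h1
  obtain ⟨x, hx, hx'⟩ := Finset.exists_mem_notMem_of_card_lt_card (s := X) (t := G.neighborFinset v) (by omega)
  exact ⟨x, by simpa using hx, hx'⟩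

theorem no_k23 (hΔ : ∀ u, G.degree u ≤ 4) (hE : ExtP G) (p q x y z : V) (hpq : p ≠ q)
    (hxy : x ≠ y) (hyz : y ≠ z) (hxz : x ≠ z) (px : G.Adj p x) (py : G.Adj p y) (pz : G.Adj p z)
    (qx : G.Adj q x) (qy : G.Adj q y) (qz : G.Adj q z) : False := by
  have tri := no_triangle G hΔ hE
  have nxy : ¬ G.Adj x y := fun h => tri p x y px h py
  have nyz : ¬ G.Adj y z := fun h => tri p y z py h pz
  have nxz : ¬ G.Adj x z := fun h => tri p x z px h pz
  have npq : ¬ G.Adj p q := fun h => tri p q x h qx px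
  have main : ∀ x y z : V, x ≠ y → y ≠ z → x ≠ z → ¬ G.Adj x y → G.Adj p x → G.Adj q x → 
      G.Adj p y → G.Adj q y → G.Adj p z → G.Adj q z → 
      ∀ x1 y1, G.Adj x x1 → G.Adj y y1 → x1 ≠ p → x1 ≠ q → y1 ≠ p → y1 ≠ q → G.Adj x1 y1 := by
    intro x y z hxy hyz hxz nxy px qx py qy pz qz x1 y1 h1 h2 h3 h4 h5 h6
    have e1 : x1 ≠ y := by rintro rfl; exact nxy h1
    have e2 : y1 ≠ x := by rintro rfl; exact nxy h2.symm
    exact k23b G hΔ hE p x q y z x1 y1 ⟨px, qx.symm, qy, py.symm, hpq, hxy, npq, nxy⟩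
      (by simp [SS, pz.ne', qz.ne', hxz.symm, hyz.symm]) 
      (by simp [SS, h3, h4, h1.ne', e1]) (by simp [SS, h5, h6, h2.ne', e2]) pz qz h1 h2
  have hcard : ({p, q} : Finset V).card ≤ 3 := Finset.card_le_two.trans (by norm_num)
  obtain ⟨x1, hx1, hx1'⟩ := exists_nbr G hΔ hE x p px.symm {p, q} hcard
  obtain ⟨y1, hy1, hy1'⟩ := exists_nbr G hΔ hE y p py.symm {p, q} hcard
  obtain ⟨z1, hz1, hz1'⟩ := exists_nbr G hΔ hE z p pz.symm {p, q} hcard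
  simp only [Finset.mem_insert, Finset.mem_singleton, not_or] at hx1' hy1' hz1'
  exact tri x1 y1 z1
    (main x y z hxy hyz hxz nxy px qx py qy pz qz x1 y1 hx1 hy1 hx1'.1 hx1'.2 hy1'.1 hy1'.2)
    (main y z x hyz hxz.symm hxy.symm nyz py qy pz qz px qx y1 z1 hy1 hz1 hy1'.1 hy1'.2 hz1'.1 hz1'.2)
    (main x z y hxz hyz.symm hxy nxz px qx pz qz py qy x1 z1 hx1 hz1 hx1'.1 hx1'.2 hz1'.1 hz1'.2)

/-- nonconflicting opposite pendants at `a` and `c` -/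
theorem opp_pair (hΔ : ∀ u, G.degree u ≤ 4) (hE : ExtP G) (a b c d : V) (h : C4 G a b c d) :
    ∃ x y, x ∉ SS a b c d ∧ y ∉ SS a b c d ∧ G.Adj a x ∧ G.Adj c y ∧ 
      ¬ EdgeClose G s(a, x) s(c, y) := by
  obtain ⟨ab, bc, cd, da, ac, bd, nac, nbd⟩ := h
  obtain ⟨x, hx, hx'⟩ := exists_nbr G hΔ hE a b ab {b, d} (Finset.card_le_two.trans (by norm_num))
  obtain ⟨x2, hx2, hx2'⟩ := exists_nbr G hΔ hE a b ab {b, d, x} Finset.card_le_three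
  obtain ⟨y, hy, hy'⟩ := exists_nbr G hΔ hE c d cd {b, d} (Finset.card_le_two.trans (by norm_num))
  obtain ⟨y2, hy2, hy2'⟩ := exists_nbr G hΔ hE c d cd {b, d, y} Finset.card_le_three
  simp only [Finset.mem_insert, Finset.mem_singleton, not_or] at hx' hx2' hy' hy2'
  have hno : ∀ t, t ≠ b → t ≠ d → G.Adj a t → G.Adj c t → False := by
    intro t h1 h2 h3 h4
    exact no_k23 G hΔ hE a c b d t ac bd h2.symm h1.symm ab da.symm h3 bc.symm cd h4
  have fin : ∀ x y, G.Adj a x → x ≠ b → x ≠ d → G.Adj c y → y ≠ b → y ≠ d → ¬ G.Adj x y →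
      ∃ x y, x ∉ SS a b c d ∧ y ∉ SS a b c d ∧ G.Adj a x ∧ G.Adj c y ∧ 
      ¬ EdgeClose G s(a, x) s(c, y) := by
    intro x y hx hxb hxd hy hyb hyd hxy
    have hxc : x ≠ c := by rintro rfl; exact nac hx
    have hya : y ≠ a := by rintro rfl; exact nac hy.symm
    refine ⟨x, y, by simp [SS, hx.ne', hxb, hxd, hxc], by simp [SS, hy.ne', hyb, hyd, hya], 
      hx, hy, ?_⟩
    rintro ⟨u, v, hu, hv, huv⟩
    rw [Sym2.mem_iff] at hu hv
    rcases hu with rfl | rfl <;> rcases hv with rfl | rfl <;> rcases huv with huv | huv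
    · exact ac huv
    · exact nac huv
    · exact hya huv.symm
    · exact hno _ hyb hyd huv hy
    · exact hxc huv
    · exact hno _ hxb hxd hx huv.symm
    · subst huv
      exact hno _ hxb hxd hx hy
    · exact hxy huv
  by_contra hcon
  have adj : ∀ x y, G.Adj a x → x ≠ b → x ≠ d → G.Adj c y → y ≠ b → y ≠ d → G.Adj x y := by
    intro x y h1 h2 h3 h4 h5 h6
    by_contra h7
    exact hcon (fin x y h1 h2 h3 h4 h5 h6 h7)
  have hxc : x ≠ c := by rintro rfl; exact nac hx
  have hx2c : x2 ≠ c := by rintro rfl; exact nac hx2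
  refine no_k23 G hΔ hE y y2 c x x2 (Ne.symm hy2'.2.2) hxc.symm (Ne.symm hx2'.2.2) hx2c.symm
    hy.symm (adj x y hx hx'.1 hx'.2 hy hy'.1 hy'.2).symm 
    (adj x2 y hx2 hx2'.1 hx2'.2.1 hy hy'.1 hy'.2).symm hy2.symm
    (adj x y2 hx hx'.1 hx'.2 hy2 hy2'.1 hy2'.2.1).symm 
    (adj x2 y2 hx2 hx2'.1 hx2'.2.1 hy2 hy2'.1 hy2'.2.1).symm

theorem no_c4 (hΔ : ∀ u, G.degree u ≤ 4) (hE : ExtP G) (a b c d : V) (ab : G.Adj a b)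
    (bc : G.Adj b c) (cd : G.Adj c d) (da : G.Adj d a) (ac : a ≠ c) (bd : b ≠ d) : False := by
  have tri := no_triangle G hΔ hE
  have h : C4 G a b c d := ⟨ab, bc, cd, da, ac, bd, fun h => tri a b c ab bc h, 
    fun h => tri b c d bc cd h⟩
  have h' : C4 G b c d a := ⟨bc, cd, da, ab, bd, ac.symm, h.nbd, fun k => h.nac k.symm⟩
  have hSS : SS b c d a = SS a b c d := by
    ext x
    simp only [SS, Finset.mem_insert, Finset.mem_singleton]
    tauto
  obtain ⟨x, y, hx, hy, ax, cy, n1⟩ := opp_pair G hΔ hE a b c d h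
  obtain ⟨z, w, hz, hw, bz, dw, n2⟩ := opp_pair G hΔ hE b c d a h'
  rw [hSS] at hz hw
  obtain ⟨hS, hU, hP, A, hA, hC, hA7, hA'⟩ := c4_data G hΔ hE a b c d h
  have hC := hC ∅ (by simp)
  have aS : a ∈ SS a b c d := by simp [SS]
  have bS : b ∈ SS a b c d := by simp [SS]
  have cS : c ∈ SS a b c d := by simp [SS]
  have dS : d ∈ SS a b c d := by simp [SS]
  have ne : ∀ u v p q, u ∈ SS a b c d → q ∉ SS a b c d → u ≠ v → s(u, p) ≠ s(v, q) := by
    intro u v p q hu hq huv he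
    rw [Sym2.eq_iff] at he
    rcases he with he | he
    · exact huv he.1
    · exact hq (he.1 ▸ hu)
  obtain ⟨g, hg, hg'⟩ := two_pair' (UU G (SS a b c d)) (CC a b c d) A hU hP hC hA7
    s(a, x) s(c, y) s(b, z) s(d, w) 
    (ne _ _ _ _ aS hy ac) (pend_mem G a b c d a x aS hx ax) (pend_mem G a b c d c y cS hy cy)
    (ne _ _ _ _ bS hw bd) (pend_mem G a b c d b z bS hz bz) (pend_mem G a b c d d w dS hw dw)
    (ne _ _ _ _ aS hz ab.ne) (ne _ _ _ _ aS hw da.ne') (ne _ _ _ _ cS hz bc.ne') 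
    (ne _ _ _ _ cS hw cd.ne)
  obtain ⟨e, he, f, hf, h', hne, hcl⟩ := hA' g hg
  rcases hg' e he f hf h' with h1 | ⟨rfl, rfl⟩ | ⟨rfl, rfl⟩ | ⟨rfl, rfl⟩ | ⟨rfl, rfl⟩
  · exact hne h1
  · exact n1 hcl
  · exact n1 (close_comm G _ _ hcl)
  · exact n2 hcl
  · exact n2 (close_comm G _ _ hcl)

end Helpers

/-- A minimal counterexample (for lists of size 22) among connected simple
graphs with maximum degree at most 4 has no cycle of length 4. -/
theorem minimal_counterexample_no_cycle
    {V : Type*} [Fintype V] (G : SimpleGraph V) [DecidableRel G.Adj]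
    (hconn : G.Connected) (hΔ : ∀ u, G.degree u ≤ 4)
    (L : Sym2 V → Finset ℕ) (hL : ∀ e ∈ G.edgeSet, 22 ≤ (L e).card)
    (hG : ¬ StronglyLColorable G L)
    (hmin : ∀ H : SimpleGraph V, H < G → StronglyLColorable H L) :
    ¬ ∃ (v : V) (p : G.Walk v v), p.IsCycle ∧ p.length = 4 := by
  classical
  rintro ⟨v, p, hp, hlen⟩
  have hE := extP G L hL hG hmin
  match p, hp, hlen with
  | .cons (v := b) hab (.cons (v := c) hbc (.cons (v := d) hcd (.cons hda .nil))), hp, _ =>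
    have hnd := hp.support_nodup
    simp at hnd
    exact no_c4 G hΔ hE v b c d hab hbc hcd hda (by grind) (by grind)
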